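/- arXiv:0809.4401 — 2 statements merged into one kernel-verified Lean document; each statement's English description precedes it below -/
import Mathlib

section
/- The Choi operator of the twirling channel equals ω_T := ∫_{U(d)} ω_{U⊗U} dU = (1/d₊) · P₊ ⊗ P₊ + (1/d₋) · P₋ ⊗ P₋ (Kronecker product of the d²×d² projectors P₊, P₋ with themselves), where the integral is the Bochner integral with respect to the normalized Haar measure on U(d). -/
open MeasureTheory Matrix
open scoped Kronecker

noncomputable instance matNormedAddCommGroup {m n : Type*} [Fintype m] [Fintype n] :
    NormedAddCommGroup (Matrix m n ℂ) := Matrix.frobeniusNormedAddCommGroup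
noncomputable instance matNormedSpace {m n : Type*} [Fintype m] [Fintype n] :
    NormedSpace ℝ (Matrix m n ℂ) := Matrix.frobeniusNormedSpace

noncomputable instance {d : ℕ} :
    MeasurableSpace (Matrix.unitaryGroup (Fin d) ℂ) := borel _
instance {d : ℕ} : BorelSpace (Matrix.unitaryGroup (Fin d) ℂ) := ⟨rfl⟩

/-- The swap operator `S` on `ℂ^d ⊗ ℂ^d`. -/
def swapOp (d : ℕ) : Matrix (Fin d × Fin d) (Fin d × Fin d) ℂ :=
  Matrix.of fun p q => if p.1 = q.2 ∧ p.2 = q.1 then 1 else 0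

/-- The projector onto the symmetric subspace, `P₊ = (I + S)/2`. -/
noncomputable def Pplus (d : ℕ) : Matrix (Fin d × Fin d) (Fin d × Fin d) ℂ :=
  (2⁻¹ : ℂ) • (1 + swapOp d)

/-- The projector onto the antisymmetric subspace, `P₋ = (I - S)/2`. -/
noncomputable def Pminus (d : ℕ) : Matrix (Fin d × Fin d) (Fin d × Fin d) ℂ :=
  (2⁻¹ : ℂ) • (1 - swapOp d)

/-- The unnormalized maximally entangled vector `|Ψ⁺⟩ = Σ_a e_a ⊗ e_a` on
`ℂ^D ⊗ ℂ^D` for `D = d²`. -/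
def psiPlusVec (d : ℕ) : (Fin d × Fin d) × (Fin d × Fin d) → ℂ :=
  fun p => if p.1 = p.2 then 1 else 0

/-- The rank-one operator `Ψ⁺ = |Ψ⁺⟩⟨Ψ⁺|`. -/
noncomputable def psiPlus (d : ℕ) :
    Matrix ((Fin d × Fin d) × (Fin d × Fin d)) ((Fin d × Fin d) × (Fin d × Fin d)) ℂ :=
  Matrix.vecMulVec (psiPlusVec d) (star (psiPlusVec d))

/-- Choi operator `ω_{U⊗V} = (I_D ⊗ (U ⊗ V)) Ψ⁺ (I_D ⊗ (U ⊗ V))†` of the product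
channel `E_U ⊗ E_V`. -/
noncomputable def omegaUV (d : ℕ) (U V : Matrix (Fin d) (Fin d) ℂ) :
    Matrix ((Fin d × Fin d) × (Fin d × Fin d)) ((Fin d × Fin d) × (Fin d × Fin d)) ℂ :=
  ((1 : Matrix (Fin d × Fin d) (Fin d × Fin d) ℂ) ⊗ₖ (U ⊗ₖ V)) * psiPlus d *
    ((1 : Matrix (Fin d × Fin d) (Fin d × Fin d) ℂ) ⊗ₖ (U ⊗ₖ V))ᴴ

section Commutant

variable {n : Type*} [Fintype n] [DecidableEq n]

theorem Matrix.diagonal_mem_unitaryGroup {w : n → ℂ} (hw : ∀ i, w i * star (w i) = 1) :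
    diagonal w ∈ unitaryGroup n ℂ := by
  rw [mem_unitaryGroup_iff, star_eq_conjTranspose, diagonal_conjTranspose, diagonal_mul_diagonal,
    ← diagonal_one]
  exact congrArg diagonal (funext hw)

theorem Equiv.Perm.permMatrix_mem_unitaryGroup (σ : Equiv.Perm n) :
    σ.permMatrix ℂ ∈ unitaryGroup n ℂ := by
  rw [mem_unitaryGroup_iff, star_eq_conjTranspose, conjTranspose_permMatrix, ← permMatrix_mul]
  simp

/-- There is a unitary matrix without zero entries. -/
theorem Matrix.exists_mem_unitaryGroup_forall_ne_zero [Nontrivial n] :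
    ∃ W ∈ unitaryGroup n ℂ, ∀ i j, W i j ≠ 0 := by
  have hn : (Fintype.card n : ℂ) ≠ 0 := Nat.cast_ne_zero.2 Fintype.card_ne_zero
  refine ⟨of fun i j => (if i = j then 1 else 0) - (1 - Complex.I) / Fintype.card n, ?_, ?_⟩
  · rw [mem_unitaryGroup_iff]
    ext i j
    simp only [mul_apply, star_apply, of_apply, one_apply, star_sub, star_div₀, RCLike.star_def,
      map_one, Complex.conj_I, map_natCast, apply_ite (starRingEnd ℂ), map_zero]
    simp only [sub_mul, mul_sub, ite_mul, mul_ite, one_mul, mul_one, zero_mul, mul_zero,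
      Finset.sum_sub_distrib, Finset.sum_ite_eq, Finset.mem_univ, if_true, Finset.sum_const,
      Finset.card_univ, nsmul_eq_mul]
    field_simp
    linear_combination -Complex.I_sq
  · intro i j h
    have him := congrArg Complex.im h
    simp only [of_apply] at him
    rw [Complex.sub_im, Complex.div_natCast_im] at him
    split_ifs at him <;> simp at him

variable {Y : Matrix (n × n) (n × n) ℂ}

theorem apply_eq_zero_of_kronecker_commute
    (hY : ∀ W ∈ unitaryGroup n ℂ, (W ⊗ₖ W) * Y = Y * (W ⊗ₖ W)) {p q : n × n}
    (h₁ : p ≠ q) (h₂ : p ≠ q.swap) : Y p q = 0 := by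
  by_contra hne
  have key (m : n) : (if p.1 = m then Complex.I else 1) * (if p.2 = m then Complex.I else 1)
      = (if q.1 = m then Complex.I else 1) * (if q.2 = m then Complex.I else 1) := by
    have h := congrFun (congrFun (hY (diagonal fun i => if i = m then Complex.I else 1)
      (diagonal_mem_unitaryGroup fun i => by split_ifs <;> simp)) p) q
    rw [diagonal_kronecker_diagonal, diagonal_mul, mul_diagonal, mul_comm] at h
    exact mul_left_cancel₀ hne h
  have hI : Complex.I ≠ 1 := fun h => by simpa using congrArg Complex.re h
  have hI' : Complex.I * Complex.I ≠ 1 := by rw [Complex.I_mul_I]; norm_num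
  have hI'' : Complex.I * Complex.I ≠ Complex.I := by
    rw [Complex.I_mul_I]; exact fun h => by simpa using congrArg Complex.re h
  obtain ⟨i, j⟩ := p
  obtain ⟨k, l⟩ := q
  have h1 := key i
  have h2 := key j
  have h3 := key k
  have h4 := key l
  simp only [Prod.swap_prod_mk, ne_eq, Prod.mk.injEq] at *
  grind

theorem apply_perm_of_kronecker_commute
    (hY : ∀ W ∈ unitaryGroup n ℂ, (W ⊗ₖ W) * Y = Y * (W ⊗ₖ W)) (σ : Equiv.Perm n)
    (i j k l : n) : Y (σ i, σ j) (σ k, σ l) = Y (i, j) (k, l) := by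
  have h := congrFun (congrFun (hY _ σ.permMatrix_mem_unitaryGroup) (i, j)) (σ k, σ l)
  simpa [mul_apply, Fintype.sum_prod_type, Equiv.Perm.permMatrix, PEquiv.toMatrix_apply,
    ite_and, Equiv.toPEquiv_apply] using h

theorem Equiv.Perm.exists_apply_eq_and_apply_eq {α : Type*} [DecidableEq α] {i j k l : α}
    (hij : i ≠ j) (hkl : k ≠ l) : ∃ σ : Equiv.Perm α, σ i = k ∧ σ j = l := by
  refine ⟨Equiv.swap (Equiv.swap i k j) l * Equiv.swap i k, ?_, ?_⟩
  · rw [Equiv.Perm.mul_apply, Equiv.swap_apply_left, Equiv.swap_apply_of_ne_of_ne _ hkl]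
    rw [← Equiv.swap_apply_left i k]
    exact fun h => hij ((Equiv.swap i k).injective (by simpa using h))
  · simp

theorem apply_diag_of_kronecker_commute
    (hY : ∀ W ∈ unitaryGroup n ℂ, (W ⊗ₖ W) * Y = Y * (W ⊗ₖ W)) {i j : n} (hij : i ≠ j) :
    Y (i, i) (i, i) = Y (i, j) (i, j) + Y (j, i) (i, j) := by
  have : Nontrivial n := ⟨i, j, hij⟩
  obtain ⟨W, hW, hW0⟩ := exists_mem_unitaryGroup_forall_ne_zero (n := n)
  have h := congrFun (congrFun (hY W hW) (i, i)) (i, j)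
  rw [mul_apply, mul_apply, Finset.sum_eq_add (i, j) (j, i) (by simp [hij])
    (fun c _ hc => by
      rw [apply_eq_zero_of_kronecker_commute hY hc.1 (by simpa using hc.2), mul_zero])
    (by simp) (by simp), Finset.sum_eq_single (i, i)
    (fun c _ hc => by
      rw [apply_eq_zero_of_kronecker_commute hY hc.symm
        (fun h => hc (by rw [← Prod.swap_swap c, ← h]; rfl)), zero_mul]) (by simp)] at h
  simp only [kronecker_apply] at h
  have h0 := mul_ne_zero (hW0 i i) (hW0 i j)
  apply mul_left_cancel₀ h0
  linear_combination -h

/-- The commutant of `{W ⊗ W}`, `W` unitary, is spanned by the identity and the swap. -/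
theorem exists_eq_add_swap_of_kronecker_commute [Nontrivial n]
    (hY : ∀ W ∈ unitaryGroup n ℂ, (W ⊗ₖ W) * Y = Y * (W ⊗ₖ W)) :
    ∃ α β : ℂ, ∀ p q, Y p q = (if p = q then α else 0) + (if p = q.swap then β else 0) := by
  obtain ⟨a, b, hab⟩ := exists_pair_ne n
  refine ⟨Y (a, b) (a, b), Y (b, a) (a, b), fun p q => ?_⟩
  by_cases h₁ : p = q
  · subst h₁
    obtain ⟨i, j⟩ := p
    by_cases hij : i = j
    · subst hij
      obtain ⟨c, hc⟩ := exists_ne i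
      obtain ⟨σ, rfl, rfl⟩ := Equiv.Perm.exists_apply_eq_and_apply_eq hab hc.symm
      rw [apply_diag_of_kronecker_commute hY hc.symm]
      simp [apply_perm_of_kronecker_commute hY]
    · obtain ⟨σ, rfl, rfl⟩ := Equiv.Perm.exists_apply_eq_and_apply_eq hab hij
      simp [apply_perm_of_kronecker_commute hY, hab]
  · by_cases h₂ : p = q.swap
    · subst h₂
      obtain ⟨i, j⟩ := q
      have hij : i ≠ j := fun h => h₁ (by simp [h])
      obtain ⟨σ, rfl, rfl⟩ := Equiv.Perm.exists_apply_eq_and_apply_eq hab hij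
      simp [apply_perm_of_kronecker_commute hY, hab, hab.symm]
    · simp [apply_eq_zero_of_kronecker_commute hY h₁ h₂, h₁, h₂]

end Commutant

section Integral

variable {X ι E : Type*} [MeasurableSpace X] {μ : Measure X} [Fintype ι]
  [NormedAddCommGroup E] [NormedSpace ℝ E] [CompleteSpace E]

theorem integral_sum_linearMap {F : Type*} [NormedAddCommGroup F] [NormedSpace ℝ F]
    [FiniteDimensional ℝ F] [CompleteSpace F] (L : ι → F →ₗ[ℝ] E) {f : ι → X → F}
    (hf : ∀ i, Integrable (f i) μ) :
    ∫ x, ∑ i, L i (f i x) ∂μ = ∑ i, L i (∫ x, f i x ∂μ) := by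
  refine (integral_finsetSum _
    fun i _ => (L i).toContinuousLinearMap.integrable_comp (hf i)).trans ?_
  exact Finset.sum_congr rfl fun i _ => (L i).toContinuousLinearMap.integral_comp_comm (hf i)

theorem Matrix.integral_apply {m n : Type*} [Fintype m] [Fintype n]
    {F : X → Matrix m n ℂ} (hF : ∀ i j, Integrable (fun x => F x i j) μ) (i : m) (j : n) :
    (∫ x, F x ∂μ) i j = ∫ x, F x i j ∂μ := by
  classical
  have hsum (M : m × n → ℂ) :
      ∑ p, singleLinearMap ℝ p.1 p.2 (M p) = (of fun i j => M (i, j) : Matrix m n ℂ) := by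
    rw [Fintype.sum_prod_type, matrix_eq_sum_single (of fun i j => M (i, j))]
    rfl
  have : CompleteSpace (Matrix m n ℂ) := FiniteDimensional.complete ℝ _
  have h := integral_sum_linearMap (μ := μ)
    (fun p : m × n => singleLinearMap (α := ℂ) ℝ p.1 p.2) (f := fun p x => F x p.1 p.2)
    fun p => hF p.1 p.2
  simp only [hsum] at h
  exact congrFun (congrFun h i) j

end Integral

section Moment

variable {d : ℕ}

theorem integrable_kronecker_mul_star_kronecker {μ : Measure (unitaryGroup (Fin d) ℂ)}
    [IsFiniteMeasure μ] (a a' b b' : Fin d × Fin d) :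
    Integrable (fun U : unitaryGroup (Fin d) ℂ =>
      ((U : Matrix (Fin d) (Fin d) ℂ) ⊗ₖ (U : Matrix (Fin d) (Fin d) ℂ)) b a *
        star (((U : Matrix (Fin d) (Fin d) ℂ) ⊗ₖ (U : Matrix (Fin d) (Fin d) ℂ)) b' a')) μ := by
  have hc (i j : Fin d) : Continuous fun U : unitaryGroup (Fin d) ℂ => U.1 i j :=
    continuous_subtype_val.matrix_elem i j
  refine Integrable.of_bound (Continuous.aestronglyMeasurable ?_) 1 (.of_forall fun U => ?_)
  · simp only [kroneckerMap_apply]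
    exact ((hc _ _).mul (hc _ _)).mul ((hc _ _).mul (hc _ _)).star
  · have hU := kronecker_mem_unitary U.2 U.2
    rw [norm_mul, norm_star]
    exact mul_le_one₀ (entry_norm_bound_of_unitary hU b a) (norm_nonneg _)
      (entry_norm_bound_of_unitary hU b' a')

theorem omegaUV_apply (U V : Matrix (Fin d) (Fin d) ℂ)
    (p q : (Fin d × Fin d) × (Fin d × Fin d)) :
    omegaUV d U V p q = (U ⊗ₖ V) p.2 p.1 * star ((U ⊗ₖ V) q.2 q.1) := by
  have h (p : (Fin d × Fin d) × (Fin d × Fin d)) :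
      (((1 : Matrix (Fin d × Fin d) (Fin d × Fin d) ℂ) ⊗ₖ (U ⊗ₖ V)) *ᵥ psiPlusVec d) p
        = (U ⊗ₖ V) p.2 p.1 := by
    rw [mulVec, dotProduct, Fintype.sum_prod_type]
    simp only [kroneckerMap_apply (fun x y : ℂ => x * y)
        (1 : Matrix (Fin d × Fin d) (Fin d × Fin d) ℂ),
      psiPlusVec, one_apply, ite_mul, mul_ite, one_mul, mul_one, zero_mul, mul_zero,
      Finset.sum_ite_eq, Finset.mem_univ, if_true]
  rw [omegaUV, psiPlus, mul_vecMulVec, vecMulVec_mul, ← star_mulVec, vecMulVec_apply, h,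
    Pi.star_apply, h]

variable (μ : Measure (unitaryGroup (Fin d) ℂ))

/-- The second moments of a measure on the unitary group: the image of the matrix unit at `(a, a')`
under the twirling channel. -/
noncomputable def unitaryMoment (a a' : Fin d × Fin d) :
    Matrix (Fin d × Fin d) (Fin d × Fin d) ℂ :=
  of fun b b' => ∫ U : unitaryGroup (Fin d) ℂ, (U.1 ⊗ₖ U.1) b a * star ((U.1 ⊗ₖ U.1) b' a') ∂μ

theorem unitaryMoment_commute [μ.IsMulLeftInvariant] [IsFiniteMeasure μ]
    (a a' : Fin d × Fin d) {W : Matrix (Fin d) (Fin d) ℂ} (hW : W ∈ unitaryGroup (Fin d) ℂ) :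
    (W ⊗ₖ W) * unitaryMoment μ a a' = unitaryMoment μ a a' * (W ⊗ₖ W) := by
  have h : unitaryMoment μ a a' = (W ⊗ₖ W) * unitaryMoment μ a a' * (W ⊗ₖ W)ᴴ := by
    ext b b'
    simp only [unitaryMoment, mul_apply, of_apply, conjTranspose_apply]
    rw [← integral_mul_left_eq_self _ (⟨W, hW⟩ : unitaryGroup (Fin d) ℂ)]
    simp_rw [Finset.sum_mul, ← integral_const_mul, ← integral_mul_const]
    have hint (c c' : Fin d × Fin d) := ((integrable_kronecker_mul_star_kronecker (μ := μ)
      a a' c c').const_mul ((W ⊗ₖ W) b c)).mul_const (star ((W ⊗ₖ W) b' c'))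
    rw [Finset.sum_congr rfl fun c' _ => (integral_finsetSum _ fun c _ => hint c c').symm,
      ← integral_finsetSum _ fun c' _ => integrable_finsetSum _ fun c _ => hint c c']
    refine integral_congr_ae (.of_forall fun U => ?_)
    simp only [Submonoid.coe_mul, mul_kronecker_mul, mul_apply (M := W ⊗ₖ W), star_sum,
      Finset.mul_sum, Finset.sum_mul, star_mul]
    refine Finset.sum_congr rfl fun c' _ => Finset.sum_congr rfl fun c _ => ?_
    ring
  have hu : (W ⊗ₖ W)ᴴ * (W ⊗ₖ W) = 1 :=
    mem_unitaryGroup_iff'.1 (kronecker_mem_unitary hW hW)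
  conv_rhs => rw [h, Matrix.mul_assoc, hu, Matrix.mul_one]

theorem sum_unitaryMoment_diag [IsProbabilityMeasure μ] (a a' : Fin d × Fin d) :
    ∑ b, unitaryMoment μ a a' b b = if a = a' then 1 else 0 := by
  simp only [unitaryMoment, of_apply]
  rw [← integral_finsetSum _ fun b _ => integrable_kronecker_mul_star_kronecker a a' b b]
  have h (U : unitaryGroup (Fin d) ℂ) :
      ∑ b, (U.1 ⊗ₖ U.1) b a * star ((U.1 ⊗ₖ U.1) b a') = if a = a' then 1 else 0 := by
    have hu := congrFun (congrFun
      (mem_unitaryGroup_iff'.1 (kronecker_mem_unitary U.2 U.2)) a') a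
    rw [mul_apply, one_apply, if_congr eq_comm rfl rfl] at hu
    rw [← hu]
    exact Finset.sum_congr rfl fun b _ => mul_comm _ _
  simp_rw [h]
  simp

theorem unitaryMoment_swap (a a' b b' : Fin d × Fin d) :
    unitaryMoment μ a a' b b'.swap = unitaryMoment μ a a'.swap b b' := by
  simp [unitaryMoment, mul_comm]

theorem unitaryMoment_apply [μ.IsMulLeftInvariant] [IsProbabilityMeasure μ] (hd : 2 ≤ d)
    (a a' b b' : Fin d × Fin d) :
    unitaryMoment μ a a' b b' =
      (((d * (d + 1) : ℂ) / 2)⁻¹) * (Pplus d a a' * Pplus d b b')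
        + (((d * (d - 1) : ℂ) / 2)⁻¹) * (Pminus d a a' * Pminus d b b') := by
  have : Nontrivial (Fin d) := Fin.nontrivial_iff_two_le.2 hd
  obtain ⟨α, β, h⟩ := exists_eq_add_swap_of_kronecker_commute
    fun W hW => unitaryMoment_commute μ a a' hW
  have hfix (x : ℂ) : ∑ b : Fin d × Fin d, (if b = b.swap then x else 0) = d * x := by
    simp [Fintype.sum_prod_type, Prod.ext_iff, eq_comm]
  have h₁ := sum_unitaryMoment_diag μ a a'
  have h₂ := sum_unitaryMoment_diag μ a a'.swap
  simp only [← unitaryMoment_swap, h, Prod.swap_swap, Finset.sum_add_distrib, hfix, if_true,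
    Finset.sum_const, Finset.card_univ, Fintype.card_prod, Fintype.card_fin, nsmul_eq_mul,
    Nat.cast_mul] at h₁ h₂
  have hswap (p q : Fin d × Fin d) : swapOp d p q = if p = q.swap then 1 else 0 := by
    simp [swapOp, Prod.ext_iff]
  have hd0 : (d : ℂ) ≠ 0 := by exact_mod_cast (by lia : d ≠ 0)
  have hd1 : (d : ℂ) + 1 ≠ 0 := by exact_mod_cast d.succ_ne_zero
  have hd2 : (d : ℂ) - 1 ≠ 0 := sub_ne_zero.2 (by exact_mod_cast (by lia : d ≠ 1))
  simp only [h, Pplus, Pminus, Matrix.smul_apply, Matrix.add_apply,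
    Matrix.sub_apply, one_apply, hswap, smul_eq_mul]
  have hα : α = ((if a = a' then 1 else 0) * d - if a = a'.swap then 1 else 0) /
      (d * (d + 1) * (d - 1)) := by
    rw [eq_div_iff (by simp [*])]
    linear_combination d * h₁ - h₂
  have hβ : β = ((if a = a'.swap then 1 else 0) * d - if a = a' then 1 else 0) /
      (d * (d + 1) * (d - 1)) := by
    rw [eq_div_iff (by simp [*])]
    linear_combination d * h₂ - h₁
  rw [← mul_boole _ α, ← mul_boole _ β, hα, hβ]
  generalize (if a = a' then (1 : ℂ) else 0) = s
  generalize (if a = a'.swap then (1 : ℂ) else 0) = t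
  field_simp
  ring

end Moment

/-- The Choi operator of the twirling channel:
`ω_T = ∫ ω_{U⊗U} dU = (1/d₊) P₊ ⊗ P₊ + (1/d₋) P₋ ⊗ P₋`. -/
theorem choi_of_twirling (d : ℕ) (hd : 2 ≤ d)
    (μ : Measure (Matrix.unitaryGroup (Fin d) ℂ))
    [μ.IsHaarMeasure] [IsProbabilityMeasure μ] :
    (∫ U : Matrix.unitaryGroup (Fin d) ℂ,
        omegaUV d (U : Matrix (Fin d) (Fin d) ℂ) (U : Matrix (Fin d) (Fin d) ℂ) ∂μ)
      = (((d * (d + 1) : ℂ) / 2)⁻¹) • (Pplus d ⊗ₖ Pplus d)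
        + (((d * (d - 1) : ℂ) / 2)⁻¹) • (Pminus d ⊗ₖ Pminus d) := by
  ext p q
  rw [Matrix.integral_apply fun p q => by
    simpa only [omegaUV_apply] using
      integrable_kronecker_mul_star_kronecker (μ := μ) p.1 q.1 p.2 q.2]
  simp_rw [omegaUV_apply]
  exact unitaryMoment_apply μ hd p.1 q.1 p.2 q.2
end

section
/- (Theorem 2, uniqueness of the optimal comparator) Suppose M_diff and M_? are positive semidefinite d⁴×d⁴ matrices with M_diff + M_? = ρᵀ ⊗ I_D for some density matrix ρ on ℂ^D (D = d²), satisfying tr(ω_{U⊗U} M_diff) = 0 for every U ∈ U(d), and attaining the optimal success probability (1/d²) tr(M_diff) = (d+1)/(2d). Then necessarily M_diff = ρᵀ ⊗ P₊ and M_? = ρᵀ ⊗ P₋, and ρ is antisymmetric, i.e. P₋ ρ P₋ = ρ. -/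
open MeasureTheory Matrix
open scoped Kronecker ComplexOrder

namespace Matrix

variable {n m : Type*} [Fintype n] [Fintype m]

theorem PosSemidef.re_trace_nonneg {M : Matrix n n ℂ} (hM : M.PosSemidef) : 0 ≤ M.trace.re :=
  (Complex.le_def.1 hM.trace_nonneg).1

theorem trace_mul_isStarProjection {M P : Matrix n n ℂ} (hP : IsStarProjection P) :
    (M * P).trace = (Pᴴ * M * P).trace := by
  have h1 : Pᴴ = P := hP.isSelfAdjoint
  have h2 : P * P = P := hP.isIdempotentElem
  rw [h1, mul_assoc, trace_mul_comm P, mul_assoc, h2]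

theorem PosSemidef.re_trace_mul_nonneg {M P : Matrix n n ℂ} (hM : M.PosSemidef)
    (hP : IsStarProjection P) : 0 ≤ (M * P).trace.re := by
  rw [trace_mul_isStarProjection hP]
  exact (hM.conjTranspose_mul_mul_same P).re_trace_nonneg

theorem _root_.IsStarProjection.kronecker {P : Matrix n n ℂ} {Q : Matrix m m ℂ}
    (hP : IsStarProjection P) (hQ : IsStarProjection Q) : IsStarProjection (P ⊗ₖ Q) := by
  constructor
  · rw [IsIdempotentElem, ← mul_kronecker_mul, hP.isIdempotentElem.eq, hQ.isIdempotentElem.eq]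
  · rw [IsSelfAdjoint, star_eq_conjTranspose, conjTranspose_kronecker, ← star_eq_conjTranspose,
      ← star_eq_conjTranspose, hP.isSelfAdjoint.star_eq, hQ.isSelfAdjoint.star_eq]

theorem PosSemidef.mulVec_eq_zero_of_trace {M : Matrix n n ℂ} (hM : M.PosSemidef) {v : n → ℂ}
    (h : (vecMulVec v (star v) * M).trace = 0) : M *ᵥ v = 0 := by
  rwa [vecMulVec_mul, trace_vecMulVec, dotProduct_comm, ← dotProduct_mulVec,
    hM.dotProduct_mulVec_zero_iff] at h

variable [DecidableEq n]

/-- A linear functional on matrices vanishing on all rank-one operators `v v†` is zero. -/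
theorem linearMap_eq_zero_of_vecMulVec_self (L : Matrix n n ℂ →ₗ[ℂ] ℂ)
    (h : ∀ v : n → ℂ, L (vecMulVec v (star v)) = 0) : L = 0 := by
  have key (v w : n → ℂ) : L (vecMulVec v (star w)) = 0 := by
    have h1 := h (v + w)
    have h2 := h (v + Complex.I • w)
    simp only [star_add, star_smul, add_vecMulVec, vecMulVec_add, smul_vecMulVec, vecMulVec_smul,
      map_add, map_smul, h, smul_eq_mul, Complex.star_def, Complex.conj_I] at h1 h2
    linear_combination (1 / 2 : ℂ) * h1 + (Complex.I / 2) * h2 +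
      (L (vecMulVec v (star w)) / 2 - L (vecMulVec w (star v)) / 2) * Complex.I_sq
  refine Matrix.ext_linearMap _ fun i j => LinearMap.ext_ring ?_
  have := key (Pi.single i 1) (Pi.single j 1)
  rw [← Pi.single_star, star_one] at this
  simpa [single_eq_single_vecMulVec_single] using this

/-- The self-adjoint unitary matrices span the space of all matrices. -/
theorem linearMap_eq_zero_of_selfAdjoint_unitary (L : Matrix n n ℂ →ₗ[ℂ] ℂ)
    (h : ∀ V : Matrix n n ℂ, Vᴴ = V → V * V = 1 → L V = 0) : L = 0 := by
  refine linearMap_eq_zero_of_vecMulVec_self L fun v => ?_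
  by_cases hv : v = 0
  · simp [hv]
  have hs : star v ⬝ᵥ v ≠ 0 := by simpa using hv
  have hreal : star (star v ⬝ᵥ v) = star v ⬝ᵥ v := (star_dotProduct v v).symm
  have h1 := h 1 (by simp) (by simp)
  have h2 := h (1 - (2 / (star v ⬝ᵥ v)) • vecMulVec v (star v))
    (by
      rw [conjTranspose_sub, conjTranspose_smul, conjTranspose_one, conjTranspose_vecMulVec,
        star_star, star_div₀, hreal]
      simp)
    (by
      rw [sub_mul, mul_sub, mul_sub, smul_mul_smul_comm, vecMulVec_mul_vecMulVec]
      simp only [vecMulVec_smul, smul_smul, one_mul, mul_one]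
      have : 2 / (star v ⬝ᵥ v) * (2 / (star v ⬝ᵥ v)) * (star v ⬝ᵥ v) =
          2 / (star v ⬝ᵥ v) + 2 / (star v ⬝ᵥ v) := by
        field_simp; norm_num
      rw [this, add_smul]
      abel)
  rw [map_sub, h1, map_smul, zero_sub, neg_eq_zero, smul_eq_mul] at h2
  exact (mul_eq_zero.1 h2).resolve_left (div_ne_zero two_ne_zero hs)

/-- A bilinear form on matrices that vanishes on the diagonal of the unitary group is
alternating. -/
theorem add_swap_eq_zero_of_unitary (F : Matrix n n ℂ →ₗ[ℂ] Matrix n n ℂ →ₗ[ℂ] ℂ)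
    (h : ∀ U ∈ unitaryGroup n ℂ, F U U = 0) (X Y : Matrix n n ℂ) : F X Y + F Y X = 0 := by
  have step (U : Matrix n n ℂ) (hU : U ∈ unitaryGroup n ℂ) (Z : Matrix n n ℂ) :
      (F + F.flip) U Z = 0 := by
    have hL : (F + F.flip) U ∘ₗ LinearMap.mulLeft ℂ U = 0 := by
      refine linearMap_eq_zero_of_selfAdjoint_unitary _ fun V hV hVV => ?_
      have hV' : V ∈ unitaryGroup n ℂ := by
        rw [mem_unitaryGroup_iff, star_eq_conjTranspose, hV, hVV]
      have hW : (3 / 5 : ℂ) • (1 : Matrix n n ℂ) + (4 / 5 * Complex.I) • V ∈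
          unitaryGroup n ℂ := by
        rw [mem_unitaryGroup_iff, star_eq_conjTranspose, conjTranspose_add, conjTranspose_smul,
          conjTranspose_smul, hV, conjTranspose_one]
        simp only [add_mul, mul_add, smul_mul_smul_comm, one_mul, mul_one, hVV]
        simp only [Complex.star_def, map_div₀, map_mul, Complex.conj_I, Complex.conj_ofNat]
        have : (4 / 5 * Complex.I * (4 / 5 * -Complex.I)) = (16 / 25 : ℂ) := by
          linear_combination (-16 / 25 : ℂ) * Complex.I_sq
        rw [this]
        module
      have h0 := h _ (mul_mem hU hW)
      have h1 := h _ hU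
      have h2 := h _ (mul_mem hU hV')
      simp only [mul_add, mul_smul_comm, mul_one, map_add, map_smul, LinearMap.add_apply,
        LinearMap.smul_apply, h1, h2, smul_eq_mul] at h0
      have hc : (3 / 5 * (4 / 5 * Complex.I) : ℂ) ≠ 0 := by simp
      refine (mul_eq_zero.1 (?_ : (3 / 5 * (4 / 5 * Complex.I) : ℂ) * _ = 0)).resolve_left hc
      simp only [LinearMap.comp_apply, LinearMap.mulLeft_apply, LinearMap.add_apply,
        LinearMap.flip_apply]
      linear_combination h0
    have := LinearMap.congr_fun hL (star U * Z)
    simpa only [LinearMap.comp_apply, LinearMap.mulLeft_apply, ← mul_assoc,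
      mem_unitaryGroup_iff.1 hU, one_mul, LinearMap.zero_apply] using this
  have hflip : (F + F.flip).flip Y = 0 :=
    linearMap_eq_zero_of_selfAdjoint_unitary _ fun V hV hVV => by
      rw [LinearMap.flip_apply]
      exact step V (by rw [mem_unitaryGroup_iff, star_eq_conjTranspose, hV, hVV]) Y
  simpa using LinearMap.congr_fun hflip X

theorem PosSemidef.mul_eq_zero_of_re_trace {M P : Matrix n n ℂ} (hM : M.PosSemidef)
    (hP : IsStarProjection P) (h : (M * P).trace.re = 0) : M * P = 0 := by
  have h0 : (Pᴴ * M * P).trace = 0 := by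
    have := Complex.le_def.1 (hM.conjTranspose_mul_mul_same P).trace_nonneg
    rw [trace_mul_isStarProjection hP] at h
    exact Complex.ext h this.2.symm
  have h1 : Pᴴ * M * P = 0 := (hM.conjTranspose_mul_mul_same P).trace_eq_zero_iff.1 h0
  refine ext_of_mulVec_single fun i => ?_
  rw [zero_mulVec, ← mulVec_mulVec, ← hM.dotProduct_mulVec_zero_iff, star_mulVec,
    ← dotProduct_mulVec, mulVec_mulVec, mulVec_mulVec, h1, zero_mulVec,
    dotProduct_zero]

theorem PosSemidef.mul_eq_zero_of_add_mul_eq_zero {M N P : Matrix n n ℂ} (hM : M.PosSemidef)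
    (hN : N.PosSemidef) (hP : IsStarProjection P) (h : (M + N) * P = 0) : M * P = 0 := by
  refine hM.mul_eq_zero_of_re_trace hP ?_
  have h1 := hM.re_trace_mul_nonneg hP
  have h2 := hN.re_trace_mul_nonneg hP
  have h3 : (M * P).trace.re + (N * P).trace.re = 0 := by
    rw [← Complex.add_re, ← trace_add, ← add_mul, h]; simp
  linarith

end Matrix

section Swap

variable (d : ℕ)

theorem mul_swapOp_apply {m : Type*} (M : Matrix m (Fin d × Fin d) ℂ) (r : m)
    (p : Fin d × Fin d) : (M * swapOp d) r p = M r p.swap := by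
  rw [Matrix.mul_apply, Finset.sum_eq_single p.swap]
  · simp [swapOp]
  · rintro q - hq
    have : ¬ (q.1 = p.2 ∧ q.2 = p.1) := fun h => hq (Prod.ext h.1 h.2)
    simp [swapOp, this]
  · simp

theorem swapOp_mul_swapOp : swapOp d * swapOp d = 1 := by
  ext p q
  rw [mul_swapOp_apply]
  simp [swapOp, Matrix.one_apply, Prod.ext_iff]

theorem swapOp_conjTranspose : (swapOp d)ᴴ = swapOp d := by
  ext p q
  simp [swapOp, apply_ite, eq_comm, and_comm]

theorem swapOp_transpose : (swapOp d)ᵀ = swapOp d := by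
  ext p q
  simp [swapOp, eq_comm, and_comm]

theorem trace_swapOp : (swapOp d).trace = d := by
  simp only [Matrix.trace, swapOp, Matrix.diag_apply, Matrix.of_apply, Fintype.sum_prod_type]
  simp [eq_comm (a := (_ : Fin d))]

theorem Pplus_transpose : (Pplus d)ᵀ = Pplus d := by
  simp [Pplus, swapOp_transpose]

theorem isStarProjection_Pplus : IsStarProjection (Pplus d) := by
  constructor
  · rw [IsIdempotentElem, Pplus, smul_mul_smul_comm, add_mul, mul_add, mul_add, swapOp_mul_swapOp]
    simp only [one_mul, mul_one]
    module
  · rw [IsSelfAdjoint, Matrix.star_eq_conjTranspose, Pplus, Matrix.conjTranspose_smul,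
      Matrix.conjTranspose_add, swapOp_conjTranspose]
    simp

theorem Pplus_add_Pminus : Pplus d + Pminus d = 1 := by
  rw [Pplus, Pminus]; module

theorem Pminus_eq : Pminus d = 1 - Pplus d := eq_sub_of_add_eq' (Pplus_add_Pminus d)

theorem isStarProjection_Pminus : IsStarProjection (Pminus d) := by
  rw [Pminus_eq]; exact (isStarProjection_Pplus d).one_sub

theorem swapOp_mul_Pplus : swapOp d * Pplus d = Pplus d := by
  rw [Pplus, mul_smul_comm, mul_add, swapOp_mul_swapOp, mul_one, add_comm]

theorem swapOp_mul_Pminus : swapOp d * Pminus d = -Pminus d := by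
  rw [Pminus, mul_smul_comm, mul_sub, swapOp_mul_swapOp, mul_one]; module

theorem trace_Pplus : (Pplus d).trace = d * (d + 1) / 2 := by
  rw [Pplus, Matrix.trace_smul, Matrix.trace_add, trace_swapOp, Matrix.trace_one]
  simp; ring

theorem trace_Pminus : (Pminus d).trace = d * (d - 1) / 2 := by
  rw [Pminus, Matrix.trace_smul, Matrix.trace_sub, trace_swapOp, Matrix.trace_one]
  simp; ring

theorem omegaUV_eq (U V : Matrix (Fin d) (Fin d) ℂ) :
    omegaUV d U V = Matrix.vecMulVec (fun p => U p.2.1 p.1.1 * V p.2.2 p.1.2)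
      (star fun p => U p.2.1 p.1.1 * V p.2.2 p.1.2) := by
  have h : ((1 : Matrix (Fin d × Fin d) (Fin d × Fin d) ℂ) ⊗ₖ (U ⊗ₖ V)) *ᵥ psiPlusVec d =
      fun p => U p.2.1 p.1.1 * V p.2.2 p.1.2 := by
    ext ⟨a, b⟩
    simp [Matrix.mulVec, dotProduct, psiPlusVec, Fintype.sum_prod_type, Matrix.one_apply,
      Matrix.kroneckerMap_apply]
  rw [omegaUV, psiPlus, Matrix.mul_vecMulVec, Matrix.vecMulVec_mul, ← Matrix.star_mulVec, h]

/-- A positive operator orthogonal to all `ω_{U⊗U}` annihilates the whole `S ⊗ S`-symmetric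
subspace. -/
theorem mul_swapOp_kronecker_swapOp
    {M : Matrix ((Fin d × Fin d) × (Fin d × Fin d)) ((Fin d × Fin d) × (Fin d × Fin d)) ℂ}
    (hM : M.PosSemidef)
    (h : ∀ U : Matrix (Fin d) (Fin d) ℂ, U ∈ Matrix.unitaryGroup (Fin d) ℂ →
      (omegaUV d U U * M).trace = 0) :
    M * (swapOp d ⊗ₖ swapOp d) = -M := by
  have key (r : (Fin d × Fin d) × (Fin d × Fin d)) (i j k l : Fin d) :
      M r ((i, j), (k, l)) + M r ((j, i), (l, k)) = 0 := by
    let F : Matrix (Fin d) (Fin d) ℂ →ₗ[ℂ] Matrix (Fin d) (Fin d) ℂ →ₗ[ℂ] ℂ :=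
      LinearMap.mk₂ ℂ (fun X Y => ∑ p, M r p * (X p.2.1 p.1.1 * Y p.2.2 p.1.2))
        (fun X X' Y => by simp [add_mul, mul_add, Finset.sum_add_distrib])
        (fun c X Y => by
          rw [smul_eq_mul, Finset.mul_sum]
          refine Finset.sum_congr rfl fun p _ => ?_
          simp only [Matrix.smul_apply, smul_eq_mul]; ring)
        (fun X Y Y' => by simp [mul_add, Finset.sum_add_distrib])
        (fun c X Y => by
          rw [smul_eq_mul, Finset.mul_sum]
          refine Finset.sum_congr rfl fun p _ => ?_
          simp only [Matrix.smul_apply, smul_eq_mul]; ring)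
    have hF (i j k l : Fin d) :
        F (Matrix.single k i 1) (Matrix.single l j 1) = M r ((i, j), (k, l)) := by
      rw [LinearMap.mk₂_apply, Finset.sum_eq_single ((i, j), (k, l))]
      · simp
      · rintro ⟨⟨a, b⟩, ⟨a', b'⟩⟩ - hne
        simp only [Matrix.single_apply]
        grind
      · simp
    have := Matrix.add_swap_eq_zero_of_unitary F (fun U hU => by
      have h0 := h U hU
      rw [omegaUV_eq] at h0
      exact congrFun (hM.mulVec_eq_zero_of_trace h0) r) (Matrix.single k i 1) (Matrix.single l j 1)
    rwa [hF, hF] at this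
  ext r ⟨⟨i, j⟩, ⟨k, l⟩⟩
  rw [Matrix.mul_apply, Finset.sum_eq_single ((j, i), (l, k))]
  · rw [Matrix.neg_apply, ← eq_neg_of_add_eq_zero_right (key r i j k l)]
    simp [swapOp, Matrix.kroneckerMap_apply]
  · rintro ⟨⟨a, b⟩, ⟨a', b'⟩⟩ - hne
    simp only [swapOp, Matrix.kroneckerMap_apply, Matrix.of_apply]
    grind
  · simp

end Swap

/-- **Theorem 2.** Any unambiguous comparator of unitary channels
attaining the optimal success probability `(d+1)/(2d)` is necessarily of the form
`M_diff = ρᵀ ⊗ P₊`, `M_? = ρᵀ ⊗ P₋` with an antisymmetric state `ρ`. -/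
theorem optimal_comparator_unique (d : ℕ) (hd : 2 ≤ d)
    (Mdiff Mq : Matrix ((Fin d × Fin d) × (Fin d × Fin d))
      ((Fin d × Fin d) × (Fin d × Fin d)) ℂ)
    (hMdiff : Mdiff.PosSemidef) (hMq : Mq.PosSemidef)
    (ρ : Matrix (Fin d × Fin d) (Fin d × Fin d) ℂ)
    (hρ : ρ.PosSemidef) (hρtr : ρ.trace = 1)
    (hsum : Mdiff + Mq = ρᵀ ⊗ₖ (1 : Matrix (Fin d × Fin d) (Fin d × Fin d) ℂ))
    (hdiff : ∀ U : Matrix (Fin d) (Fin d) ℂ, U ∈ Matrix.unitaryGroup (Fin d) ℂ →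
      (omegaUV d U U * Mdiff).trace = 0)
    (hopt : Mdiff.trace.re / (d : ℝ) ^ 2 = ((d : ℝ) + 1) / (2 * d)) :
    Mdiff = ρᵀ ⊗ₖ Pplus d ∧ Mq = ρᵀ ⊗ₖ Pminus d ∧
    Pminus d * ρ * Pminus d = ρ := by
  have hP := isStarProjection_Pplus d
  have hN := isStarProjection_Pminus d
  have hd0 : (0 : ℝ) < d := by positivity
  have hS := mul_swapOp_kronecker_swapOp d hMdiff hdiff
  have hkill {P Q : Matrix (Fin d × Fin d) (Fin d × Fin d) ℂ}
      (hPQ : (swapOp d * P) ⊗ₖ (swapOp d * Q) = P ⊗ₖ Q) : Mdiff * (P ⊗ₖ Q) = 0 := by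
    have h1 : Mdiff * (P ⊗ₖ Q) = -(Mdiff * (P ⊗ₖ Q)) := by
      conv_lhs => rw [← hPQ, Matrix.mul_kronecker_mul, ← mul_assoc, hS, neg_mul]
    ext r p
    exact self_eq_neg.1 (congrFun (congrFun h1 r) p)
  have hpp : Mdiff * (Pplus d ⊗ₖ Pplus d) = 0 := hkill (by simp only [swapOp_mul_Pplus])
  have hmm : Mdiff * (Pminus d ⊗ₖ Pminus d) = 0 := hkill (by
    rw [swapOp_mul_Pminus]; ext; simp [Matrix.kroneckerMap_apply])
  have hone : (1 : Matrix (Fin d × Fin d) (Fin d × Fin d) ℂ) ⊗ₖ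
      (1 : Matrix (Fin d × Fin d) (Fin d × Fin d) ℂ) =
      Pplus d ⊗ₖ Pplus d + Pplus d ⊗ₖ Pminus d + (Pminus d ⊗ₖ Pplus d + Pminus d ⊗ₖ Pminus d) := by
    rw [← Matrix.kronecker_add, ← Matrix.kronecker_add, ← Matrix.add_kronecker, Pplus_add_Pminus]
  have hdec : Mdiff.trace = (Mdiff * (Pplus d ⊗ₖ Pminus d)).trace +
      (Mdiff * (Pminus d ⊗ₖ Pplus d)).trace := by
    conv_lhs => rw [← mul_one Mdiff, ← Matrix.one_kronecker_one, hone]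
    simp only [mul_add, hpp, hmm, zero_add, add_zero, Matrix.trace_add]
  have htr (P Q : Matrix (Fin d × Fin d) (Fin d × Fin d) ℂ) :
      (Mdiff * (P ⊗ₖ Q)).trace + (Mq * (P ⊗ₖ Q)).trace = (ρᵀ * P).trace * Q.trace := by
    rw [← Matrix.trace_add, ← add_mul, hsum, ← Matrix.mul_kronecker_mul, one_mul,
      Matrix.trace_kronecker]
  have hab : (ρᵀ * Pplus d).trace + (ρᵀ * Pminus d).trace = 1 := by
    rw [← Matrix.trace_add, ← mul_add, Pplus_add_Pminus, mul_one, Matrix.trace_transpose, hρtr]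
  have hx := hMq.re_trace_mul_nonneg (hP.kronecker hN)
  have hy := hMq.re_trace_mul_nonneg (hN.kronecker hP)
  have ha := hρ.transpose.re_trace_mul_nonneg hP
  have htot : (Mq * (Pplus d ⊗ₖ Pminus d)).trace + (Mq * (Pminus d ⊗ₖ Pplus d)).trace +
      (d : ℂ) * (ρᵀ * Pplus d).trace = (d : ℂ) * (d + 1) / 2 - Mdiff.trace := by
    have h1 := htr (Pplus d) (Pminus d)
    have h2 := htr (Pminus d) (Pplus d)
    rw [trace_Pminus] at h1
    rw [trace_Pplus] at h2
    linear_combination h1 + h2 + hdec + (d * (d + 1) / 2 : ℂ) * hab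
  have hMtr : Mdiff.trace.re = (d : ℝ) * (d + 1) / 2 := by
    field_simp at hopt
    linarith
  have hre : (Mq * (Pplus d ⊗ₖ Pminus d)).trace.re + (Mq * (Pminus d ⊗ₖ Pplus d)).trace.re +
      d * (ρᵀ * Pplus d).trace.re = 0 := by
    have h1 := congrArg Complex.re htot
    have h2 : ((d : ℂ) * (d + 1) / 2).re = (d : ℝ) * (d + 1) / 2 := by
      rw [← Complex.ofReal_re ((d : ℝ) * (d + 1) / 2)]; push_cast; rfl
    rw [Complex.sub_re, h2, hMtr, sub_self] at h1
    simpa using h1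
  have hda : 0 ≤ d * (ρᵀ * Pplus d).trace.re := mul_nonneg hd0.le ha
  have hρP : ρᵀ * Pplus d = 0 := hρ.transpose.mul_eq_zero_of_re_trace hP
    ((mul_eq_zero.1 (by linarith : d * (ρᵀ * Pplus d).trace.re = 0)).resolve_left hd0.ne')
  have hqmp : Mq * (Pminus d ⊗ₖ Pplus d) = 0 :=
    hMq.mul_eq_zero_of_re_trace (hN.kronecker hP) (by linarith)
  have hsumP {Q : Matrix (Fin d × Fin d) (Fin d × Fin d) ℂ} :
      (Mdiff + Mq) * (Pplus d ⊗ₖ Q) = 0 := by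
    rw [hsum, ← Matrix.mul_kronecker_mul, hρP, Matrix.zero_kronecker]
  have hdpm : Mdiff * (Pplus d ⊗ₖ Pminus d) = 0 :=
    hMdiff.mul_eq_zero_of_add_mul_eq_zero hMq (hP.kronecker hN) hsumP
  have hqpp : Mq * (Pplus d ⊗ₖ Pplus d) = 0 :=
    hMq.mul_eq_zero_of_add_mul_eq_zero hMdiff (hP.kronecker hP) (by rw [add_comm]; exact hsumP)
  have hdN : Mdiff * (1 ⊗ₖ Pminus d) = 0 := by
    rw [← Pplus_add_Pminus, Matrix.add_kronecker, mul_add, hdpm, hmm, add_zero]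
  have hqP : Mq * (1 ⊗ₖ Pplus d) = 0 := by
    rw [← Pplus_add_Pminus, Matrix.add_kronecker, mul_add, hqpp, hqmp, add_zero]
  have hsplit (M : Matrix ((Fin d × Fin d) × (Fin d × Fin d))
      ((Fin d × Fin d) × (Fin d × Fin d)) ℂ) :
      M = M * (1 ⊗ₖ Pplus d) + M * (1 ⊗ₖ Pminus d) := by
    rw [← mul_add, ← Matrix.kronecker_add, Pplus_add_Pminus, Matrix.one_kronecker_one, mul_one]
  have hsum' (Q : Matrix (Fin d × Fin d) (Fin d × Fin d) ℂ) :
      Mdiff * (1 ⊗ₖ Q) + Mq * (1 ⊗ₖ Q) = ρᵀ ⊗ₖ Q := by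
    rw [← add_mul, hsum, ← Matrix.mul_kronecker_mul, mul_one, one_mul]
  refine ⟨?_, ?_, ?_⟩
  · rw [← hsum', hqP, add_zero]
    conv_lhs => rw [hsplit Mdiff, hdN, add_zero]
  · rw [← hsum', hdN, zero_add]
    conv_lhs => rw [hsplit Mq, hqP, zero_add]
  · have hl : Pplus d * ρ = 0 := by
      rw [← Matrix.transpose_inj, Matrix.transpose_mul, Pplus_transpose, hρP,
        Matrix.transpose_zero]
    have hr : ρ * Pplus d = 0 := by
      have h1 := congrArg Matrix.conjTranspose hl
      have h2 : (Pplus d)ᴴ = Pplus d := hP.isSelfAdjoint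
      rwa [Matrix.conjTranspose_mul, hρ.isHermitian.eq, h2, Matrix.conjTranspose_zero] at h1
    rw [Pminus_eq, sub_mul, one_mul, hl, sub_zero, mul_sub, mul_one, hr, sub_zero]
end
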